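/- arXiv:2309.06904 — 4 statements merged into one kernel-verified Lean document; each statement's English description precedes it below -/
import Mathlib

section
/- Let D=(V1,V2;A) be a split digraph such that every vertex of V1 has out-degree at least 3 and in-degree at least 3 in D, and let D* be a directed multigraph obtained from D by splitting off at most two pairs at every vertex of V1. If D*⟨V2⟩ has a strong arc decomposition, then D has a strong arc decomposition. -/
/-- A digraph on vertex set `V` given by its arc set `A` is strong if every vertex
can reach every other vertex by a directed path. -/
def DigraphStrong {V : Type*} (A : Finset (V × V)) : Prop :=
  ∀ x y : V, Relation.ReflTransGen (fun a b => (a, b) ∈ A) x y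

/-- A digraph is `k`-arc-strong if it remains strong after deleting any set of
at most `k - 1` arcs. -/
def ArcStrong {V : Type*} [DecidableEq V] (k : ℕ) (A : Finset (V × V)) : Prop :=
  ∀ B ⊆ A, B.card < k → DigraphStrong (A \ B)

/-- A strong arc decomposition: a partition of the arc set into two disjoint sets,
each of which forms a strong spanning subdigraph. -/
def StrongArcDecomp {V : Type*} [DecidableEq V] (A : Finset (V × V)) : Prop :=
  ∃ A₁ A₂ : Finset (V × V), A₁ ∪ A₂ = A ∧ Disjoint A₁ A₂ ∧
    DigraphStrong A₁ ∧ DigraphStrong A₂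

/-- `(V₁, V₂; A)` is a split digraph: `V₁, V₂` are nonempty, partition the vertex set,
there are no loops, `V₁` is an independent set, and the subdigraph induced by `V₂`
is semicomplete. -/
def IsSplitDigraph {V : Type*} [Fintype V] [DecidableEq V]
    (V₁ V₂ : Finset V) (A : Finset (V × V)) : Prop :=
  V₁.Nonempty ∧ V₂.Nonempty ∧ Disjoint V₁ V₂ ∧ V₁ ∪ V₂ = Finset.univ ∧
  (∀ v : V, (v, v) ∉ A) ∧
  (∀ u ∈ V₁, ∀ v ∈ V₁, (u, v) ∉ A) ∧
  (∀ u ∈ V₂, ∀ v ∈ V₂, u ≠ v → (u, v) ∈ A ∨ (v, u) ∈ A)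

/-- The out-degree of a vertex. -/
def outDeg {V : Type*} [DecidableEq V] (A : Finset (V × V)) (t : V) : ℕ :=
  (A.filter fun e => e.1 = t).card

/-- The in-degree of a vertex. -/
def inDeg {V : Type*} [DecidableEq V] (A : Finset (V × V)) (t : V) : ℕ :=
  (A.filter fun e => e.2 = t).card

/-- In a directed multigraph with arc multiset `B`, every ordered pair of vertices
of `X` is joined by a directed path all of whose vertices lie in `X`. -/
def MStrongOn {V : Type*} (X : Finset V) (B : Multiset (V × V)) : Prop :=
  ∀ x ∈ X, ∀ y ∈ X, Relation.ReflTransGen (fun a b => a ∈ X ∧ b ∈ X ∧ (a, b) ∈ B) x y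

/-- The directed multigraph `B` is obtained from the split digraph `(V₁, V₂; A)` by
splitting off the pairs recorded in `S`: each element `(u, t, v)` of `S` stands for
splitting off the pair of arcs `(ut, tv)` at `t ∈ V₁` (with `u, v ∈ V₂`, `u ≠ v`),
i.e. deleting the arcs `ut` and `tv` and adding the (possibly parallel) arc `uv`.
The arcs used by the various splittings are pairwise distinct arcs of `A`. -/
def SplitsOff {V : Type*} [DecidableEq V] (A : Finset (V × V)) (V₁ V₂ : Finset V)
    (S : Multiset (V × V × V)) (B : Multiset (V × V)) : Prop :=
  (∀ s ∈ S, s.2.1 ∈ V₁ ∧ s.1 ∈ V₂ ∧ s.2.2 ∈ V₂ ∧ s.1 ≠ s.2.2 ∧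
    (s.1, s.2.1) ∈ A ∧ (s.2.1, s.2.2) ∈ A) ∧
  (S.bind fun s => {(s.1, s.2.1), (s.2.1, s.2.2)}).Nodup ∧
  B = (A.val - S.bind fun s => {(s.1, s.2.1), (s.2.1, s.2.2)}) +
      S.map fun s => (s.1, s.2.2)

/-- A splitting of `M + S.map f` into two parts is induced by splittings of `M` and `S`. -/
lemma exists_add_map_of_add_eq {α β : Type*} (f : β → α) (M : Multiset α) :
    ∀ (S : Multiset β) (B₁ B₂ : Multiset α), B₁ + B₂ = M + S.map f →
      ∃ (M₁ M₂ : Multiset α) (S₁ S₂ : Multiset β), M₁ + M₂ = M ∧ S₁ + S₂ = S ∧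
        B₁ = M₁ + S₁.map f ∧ B₂ = M₂ + S₂.map f := by
  intro S
  induction S using Multiset.induction_on with
  | empty =>
    intro B₁ B₂ h
    exact ⟨B₁, B₂, 0, 0, by simpa using h, by simp, by simp, by simp⟩
  | cons s S ih =>
    intro B₁ B₂ h
    have hs : f s ∈ B₁ + B₂ := by simp [h]
    rcases Multiset.mem_add.1 hs with hs | hs
    · obtain ⟨C, rfl⟩ := Multiset.exists_cons_of_mem hs
      have h' : C + B₂ = M + S.map f := by simpa using h
      obtain ⟨M₁, M₂, S₁, S₂, hM, hS, h₁, h₂⟩ := ih C B₂ h'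
      exact ⟨M₁, M₂, s ::ₘ S₁, S₂, hM, by simp [hS], by simp [h₁], h₂⟩
    · obtain ⟨C, rfl⟩ := Multiset.exists_cons_of_mem hs
      have h' : B₁ + C = M + S.map f := by simpa using h
      obtain ⟨M₁, M₂, S₁, S₂, hM, hS, h₁, h₂⟩ := ih B₁ C h'
      exact ⟨M₁, M₂, S₁, s ::ₘ S₂, hM, by simp [hS], h₁, by simp [h₂]⟩

/-- Two disjoint sets covering at most two elements of a set with at least three elements
extend to a bipartition of it into nonempty parts. -/
lemma exists_nonempty_bipartition {α : Type*} [DecidableEq α] (C P₁ P₂ : Finset α)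
    (hP : Disjoint P₁ P₂) (hC : 3 ≤ C.card) (hCP : (C ∩ (P₁ ∪ P₂)).card ≤ 2) :
    ∃ D ⊆ C, C ∩ P₁ ⊆ D ∧ Disjoint D P₂ ∧ D.Nonempty ∧ (C \ D).Nonempty := by
  have hR : (C \ (P₁ ∪ P₂)).Nonempty := by
    rw [← Finset.card_pos]
    have := Finset.card_sdiff_add_card_inter C (P₁ ∪ P₂)
    omega
  obtain ⟨r, hr⟩ := hR
  simp only [Finset.mem_sdiff, Finset.mem_union, not_or] at hr
  obtain ⟨hrC, hr₁, hr₂⟩ := hr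
  by_cases h : (C ∩ P₁).Nonempty
  · exact ⟨C ∩ P₁, Finset.inter_subset_left, subset_rfl,
      hP.mono_left Finset.inter_subset_right, h, r, by simp [hrC, hr₁]⟩
  · rw [Finset.not_nonempty_iff_eq_empty] at h
    refine ⟨{r}, by simpa, by simp [h], by simpa, by simp, ?_⟩
    rw [← Finset.card_pos]
    have := Finset.le_card_sdiff {r} C
    simp only [Finset.card_singleton] at this
    omega

/-- The classwise version of `exists_nonempty_bipartition`, with classes the fibres of `k`
over `T`. -/
lemma exists_fiberwise_bipartition {α β : Type*} [DecidableEq α] [DecidableEq β] (k : α → β)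
    (T : Set β) (A P₁ P₂ : Finset α) (hP₁ : P₁ ⊆ A) (hP : Disjoint P₁ P₂)
    (hA : ∀ b ∈ T, 3 ≤ (A.filter fun a => k a = b).card)
    (hAP : ∀ b ∈ T, ((P₁ ∪ P₂).filter fun a => k a = b).card ≤ 2) :
    ∃ A₁ ⊆ A, P₁ ⊆ A₁ ∧ Disjoint A₁ P₂ ∧
      ∀ b ∈ T, (∃ a ∈ A₁, k a = b) ∧ ∃ a ∈ A \ A₁, k a = b := by
  classical
  have key : ∀ b : β, ∃ D ⊆ A.filter fun a => k a = b,
      (A.filter fun a => k a = b) ∩ P₁ ⊆ D ∧ Disjoint D P₂ ∧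
      (b ∈ T → D.Nonempty ∧ ((A.filter fun a => k a = b) \ D).Nonempty) := by
    intro b
    by_cases hb : b ∈ T
    · obtain ⟨D, h₁, h₂, h₃, h₄⟩ := exists_nonempty_bipartition
        (A.filter fun a => k a = b) P₁ P₂ hP (hA b hb)
        ((Finset.card_le_card (by intro a; simp; tauto)).trans (hAP b hb))
      exact ⟨D, h₁, h₂, h₃, fun _ => h₄⟩
    · exact ⟨(A.filter fun a => k a = b) ∩ P₁, Finset.inter_subset_left, subset_rfl,
        hP.mono_left Finset.inter_subset_right, fun h => absurd h hb⟩
  choose D hDA hDP hD₂ hDT using key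
  have hmem : ∀ b a, a ∈ D b → a ∈ A ∧ k a = b := fun b a h => Finset.mem_filter.1 (hDA b h)
  refine ⟨A.filter fun a => a ∈ D (k a), Finset.filter_subset _ _, ?_, ?_, ?_⟩
  · intro a ha
    have haA := hP₁ ha
    exact Finset.mem_filter.2 ⟨haA, hDP _ (by simp [ha, haA])⟩
  · rw [Finset.disjoint_left]
    intro a ha
    exact Finset.disjoint_left.1 (hD₂ (k a)) (Finset.mem_filter.1 ha).2
  · intro b hb
    obtain ⟨⟨a, ha⟩, a', ha'⟩ := hDT b hb
    obtain ⟨haA, rfl⟩ := hmem b a ha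
    simp only [Finset.mem_sdiff, Finset.mem_filter] at ha'
    refine ⟨⟨a, Finset.mem_filter.2 ⟨haA, ha⟩, rfl⟩, a', ?_, ha'.1.2⟩
    simp [ha'.1.1, ha'.1.2, ha'.2]

/-- If the arcs of `B`, which is strong on `X`, lift to `A` as arcs or paths of length two, and
every vertex outside `X` has an in- and an out-neighbour in `X`, then `A` is strong. -/
lemma DigraphStrong.of_lift {V : Type*} {X : Finset V} {B : Multiset (V × V)}
    {A : Finset (V × V)} (hB : MStrongOn X B)
    (hlift : ∀ e ∈ B, e ∈ A ∨ ∃ t, (e.1, t) ∈ A ∧ (t, e.2) ∈ A)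
    (hin : ∀ t ∉ X, ∃ u ∈ X, (u, t) ∈ A) (hout : ∀ t ∉ X, ∃ v ∈ X, (t, v) ∈ A) :
    DigraphStrong A := by
  have hX : ∀ x ∈ X, ∀ y ∈ X, Relation.ReflTransGen (fun a b => (a, b) ∈ A) x y := by
    intro x hx y hy
    induction hB x hx y hy with
    | refl => exact .refl
    | tail _ hbc ih =>
      rcases hlift _ hbc.2.2 with h | ⟨t, h₁, h₂⟩
      · exact (ih hbc.1).tail h
      · exact ((ih hbc.1).tail h₁).tail h₂
  have hfrom : ∀ x, ∃ u ∈ X, Relation.ReflTransGen (fun a b => (a, b) ∈ A) x u := by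
    intro x
    by_cases hx : x ∈ X
    · exact ⟨x, hx, .refl⟩
    · obtain ⟨v, hv, h⟩ := hout x hx
      exact ⟨v, hv, .single h⟩
  have hto : ∀ y, ∃ v ∈ X, Relation.ReflTransGen (fun a b => (a, b) ∈ A) v y := by
    intro y
    by_cases hy : y ∈ X
    · exact ⟨y, hy, .refl⟩
    · obtain ⟨u, hu, h⟩ := hin y hy
      exact ⟨u, hu, .single h⟩
  intro x y
  obtain ⟨u, hu, hxu⟩ := hfrom x
  obtain ⟨v, hv, hvy⟩ := hto y
  exact (hxu.trans (hX u hu v hv)).trans hvy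

/-- The arcs of the split pairs recorded in `S`. -/
def pairArcs {V : Type*} (S : Multiset (V × V × V)) : Multiset (V × V) :=
  S.bind fun s => {(s.1, s.2.1), (s.2.1, s.2.2)}

lemma mem_pairArcs {V : Type*} {S : Multiset (V × V × V)} {e : V × V} :
    e ∈ pairArcs S ↔ ∃ s ∈ S, e = (s.1, s.2.1) ∨ e = (s.2.1, s.2.2) := by
  simp only [pairArcs, Multiset.mem_bind, Multiset.insert_eq_cons, Multiset.mem_cons,
    Multiset.mem_singleton]

/-- The number of arcs in `pairArcs S` satisfying `p` is at most the number of pairs in `S`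
satisfying `q`, if at most one arc of each pair satisfies `p`, and only when the pair satisfies
`q`. -/
lemma card_filter_pairArcs_le {V : Type*} (S : Multiset (V × V × V))
    (p : V × V → Prop) (q : V × V × V → Prop) [DecidablePred p] [DecidablePred q]
    (h : ∀ s ∈ S, ¬ (p (s.1, s.2.1) ∧ p (s.2.1, s.2.2)))
    (hq : ∀ s ∈ S, p (s.1, s.2.1) ∨ p (s.2.1, s.2.2) → q s) :
    ((pairArcs S).filter p).card ≤ (S.filter q).card := by
  induction S using Multiset.induction_on with
  | empty => simp [pairArcs]
  | cons s S ih =>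
    have ih' := ih (fun s hs => h s (Multiset.mem_cons_of_mem hs))
      (fun s hs => hq s (Multiset.mem_cons_of_mem hs))
    have h₁ := h s (Multiset.mem_cons_self _ _)
    have h₂ := hq s (Multiset.mem_cons_self _ _)
    simp only [pairArcs, Multiset.cons_bind, Multiset.filter_add, Multiset.card_add,
      Multiset.filter_cons, Multiset.insert_eq_cons, Multiset.filter_singleton] at ih' ⊢
    by_cases ha : p (s.1, s.2.1) <;> by_cases hb : p (s.2.1, s.2.2) <;>
      by_cases hc : q s <;> simp_all <;> omega

/-- Lemma 2.5: let `D = (V₁, V₂; A)` be a split digraph in which every vertex of `V₁`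
has out- and in-degree at least 3, and let `D*` (with arc multiset `B`) be obtained
from `D` by splitting off at most two pairs at every vertex of `V₁`.  If `D*⟨V₂⟩` has
a strong arc decomposition then so does `D`. -/
theorem stmt3 {V : Type*} [Fintype V] [DecidableEq V]
    (V₁ V₂ : Finset V) (A : Finset (V × V))
    (hsplit : IsSplitDigraph V₁ V₂ A)
    (hdeg : ∀ t ∈ V₁, 3 ≤ outDeg A t ∧ 3 ≤ inDeg A t)
    (S : Multiset (V × V × V)) (B : Multiset (V × V))
    (hB : SplitsOff A V₁ V₂ S B)
    (htwo : ∀ t ∈ V₁, (S.filter fun s => s.2.1 = t).card ≤ 2)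
    (hdecomp : ∃ B₁ B₂ : Multiset (V × V),
      B₁ + B₂ = B.filter (fun e => e.1 ∈ V₂ ∧ e.2 ∈ V₂) ∧
      MStrongOn V₂ B₁ ∧ MStrongOn V₂ B₂) :
    StrongArcDecomp A := by
  classical
  obtain ⟨-, -, hdisj, hunion, -, hindep, -⟩ := hsplit
  obtain ⟨hS, hnodup, hBeq⟩ := hB
  obtain ⟨B₁, B₂, hB₁₂, hB₁, hB₂⟩ := hdecomp
  change (pairArcs S).Nodup at hnodup
  have hBS : B = (A.val - pairArcs S) + S.map fun s => (s.1, s.2.2) := hBeq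
  have h12 : ∀ v ∈ V₁, v ∉ V₂ := fun v h h' => Finset.disjoint_left.1 hdisj h h'
  have h21 : ∀ v, v ∉ V₂ → v ∈ V₁ := fun v h => by
    have := Finset.mem_univ v
    rw [← hunion, Finset.mem_union] at this
    tauto
  set M : Multiset (V × V) := A.val.filter fun e => e.1 ∈ V₂ ∧ e.2 ∈ V₂ with hM
  have hBM : B.filter (fun e => e.1 ∈ V₂ ∧ e.2 ∈ V₂) = M + S.map fun s => (s.1, s.2.2) := by
    rw [hBS, Multiset.filter_add, Multiset.filter_sub]
    congr 1
    · have : (pairArcs S).filter (fun e => e.1 ∈ V₂ ∧ e.2 ∈ V₂) = 0 := by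
        rw [Multiset.filter_eq_nil]
        intro e he
        obtain ⟨s, hs, rfl | rfl⟩ := mem_pairArcs.1 he <;>
          have := h12 _ (hS s hs).1 <;> tauto
      rw [this, hM, tsub_zero]
    · rw [Multiset.filter_eq_self]
      intro e he
      obtain ⟨s, hs, rfl⟩ := Multiset.mem_map.1 he
      exact ⟨(hS s hs).2.1, (hS s hs).2.2.1⟩
  obtain ⟨M₁, M₂, S₁, S₂, hM₁₂, hS₁₂, rfl, rfl⟩ :=
    exists_add_map_of_add_eq _ M S B₁ B₂ (hB₁₂.trans hBM)
  have hpair : pairArcs S₁ + pairArcs S₂ = pairArcs S := by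
    rw [← hS₁₂, pairArcs, pairArcs, pairArcs, Multiset.add_bind]
  have hMmem : ∀ e ∈ M, e ∈ A ∧ e.1 ∈ V₂ ∧ e.2 ∈ V₂ := fun e he => by simpa [hM] using he
  have hpA : ∀ e ∈ pairArcs S, e ∈ A := fun e he => by
    obtain ⟨s, hs, rfl | rfl⟩ := mem_pairArcs.1 he
    · exact (hS s hs).2.2.2.2.1
    · exact (hS s hs).2.2.2.2.2
  have hsum : (M₁ + pairArcs S₁) + (M₂ + pairArcs S₂) = M + pairArcs S := by
    rw [← hM₁₂, ← hpair]; abel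
  have hnd : (M + pairArcs S).Nodup := by
    rw [Multiset.nodup_add]
    refine ⟨A.nodup.filter _, hnodup, ?_⟩
    rw [Multiset.disjoint_left]
    intro e he he'
    have h := (hMmem e he).2
    obtain ⟨s, hs, rfl | rfl⟩ := mem_pairArcs.1 he' <;>
      have := h12 _ (hS s hs).1 <;> tauto
  have hmemA : ∀ e ∈ M + pairArcs S, e ∈ A := fun e he =>
    (Multiset.mem_add.1 he).elim (fun h => (hMmem e h).1) (hpA e)
  set P₁ := (M₁ + pairArcs S₁).toFinset with hP₁
  set P₂ := (M₂ + pairArcs S₂).toFinset with hP₂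
  have hmem₁ : ∀ e ∈ P₁, e ∈ A := fun e he =>
    hmemA e (hsum ▸ Multiset.mem_add.2 (.inl (Multiset.mem_toFinset.1 he)))
  have hmem₂ : ∀ e ∈ P₂, e ∈ A := fun e he =>
    hmemA e (hsum ▸ Multiset.mem_add.2 (.inr (Multiset.mem_toFinset.1 he)))
  have hPdisj : Disjoint P₁ P₂ := by
    rw [Multiset.disjoint_toFinset]
    exact (Multiset.nodup_add.1 (hsum ▸ hnd)).2.2
  have hPval : (P₁ ∪ P₂).val = M + pairArcs S := by
    rw [hP₁, hP₂, ← Multiset.toFinset_add, hsum, Multiset.toFinset_val, hnd.dedup]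
  let k : V × V → V ⊕ V := fun e => if e.2 ∈ V₁ then .inl e.2 else .inr e.1
  have hk_in : ∀ t ∈ V₁, ∀ e, k e = .inl t ↔ e.2 = t := by
    intro t ht e
    by_cases h : e.2 ∈ V₁ <;> simp only [k, h, if_true, if_false, Sum.inl.injEq, reduceCtorEq,
      false_iff]
    rintro rfl
    exact h ht
  have hk_out : ∀ t ∈ V₁, ∀ e ∈ A, k e = .inr t ↔ e.1 = t := by
    intro t ht e he
    by_cases h : e.2 ∈ V₁ <;> simp only [k, h, if_true, if_false, Sum.inr.injEq, reduceCtorEq,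
      false_iff]
    rintro rfl
    exact hindep _ ht _ h he
  let T : Set (V ⊕ V) := {b | ∃ t ∈ V₁, b = .inl t ∨ b = .inr t}
  obtain ⟨A₁, hA₁, hPA₁, hA₁P, hT⟩ := exists_fiberwise_bipartition k T A P₁ P₂ hmem₁ hPdisj
    (by
      rintro b ⟨t, ht, rfl | rfl⟩
      · rw [Finset.filter_congr fun e _ => hk_in t ht e]
        exact (hdeg t ht).2
      · rw [Finset.filter_congr fun e he => hk_out t ht e he]
        exact (hdeg t ht).1)
    (by
      rintro b ⟨t, ht, hb⟩
      rw [Finset.card_def, Finset.filter_val, hPval, Multiset.filter_add]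
      have h0 : M.filter (fun e => k e = b) = 0 := by
        rw [Multiset.filter_eq_nil]
        intro e he hke
        obtain ⟨heA, he₁, he₂⟩ := hMmem e he
        rcases hb with rfl | rfl
        · exact h12 t ht ((hk_in t ht e).1 hke ▸ he₂)
        · exact h12 t ht ((hk_out t ht e heA).1 hke ▸ he₁)
      rw [h0, zero_add]
      refine (card_filter_pairArcs_le S _ (fun s => s.2.1 = t) ?_ ?_).trans (htwo t ht) <;>
      · intro s hs
        obtain ⟨hs₁, hs₂, hs₃, -, hs₄, hs₅⟩ := hS s hs
        have := h12 t ht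
        rcases hb with rfl | rfl
        · rw [hk_in t ht, hk_in t ht]
          grind
        · rw [hk_out t ht _ hs₄, hk_out t ht _ hs₅]
          grind)
  have hPA₂ : P₂ ⊆ A \ A₁ := fun e he =>
    Finset.mem_sdiff.2 ⟨hmem₂ e he, fun h => Finset.disjoint_left.1 hA₁P h he⟩
  have hlift : ∀ (N : Multiset (V × V)) (R : Multiset (V × V × V)) (C : Finset (V × V)),
      (N + pairArcs R).toFinset ⊆ C → ∀ e ∈ N + R.map (fun s => (s.1, s.2.2)),
        e ∈ C ∨ ∃ t, (e.1, t) ∈ C ∧ (t, e.2) ∈ C := by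
    intro N R C hC e he
    rcases Multiset.mem_add.1 he with he | he
    · exact .inl (hC (by simp [he]))
    · obtain ⟨s, hs, rfl⟩ := Multiset.mem_map.1 he
      refine .inr ⟨s.2.1, hC ?_, hC ?_⟩ <;>
        rw [Multiset.mem_toFinset, Multiset.mem_add, mem_pairArcs]
      · exact .inr ⟨s, hs, .inl rfl⟩
      · exact .inr ⟨s, hs, .inr rfl⟩
  have hin : ∀ C ⊆ A, (∀ b ∈ T, ∃ e ∈ C, k e = b) → ∀ t ∉ V₂, ∃ u ∈ V₂, (u, t) ∈ C := by
    intro C hC hCT t ht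
    obtain ⟨e, he, hke⟩ := hCT (.inl t) ⟨t, h21 t ht, .inl rfl⟩
    obtain rfl := (hk_in t (h21 t ht) e).1 hke
    exact ⟨e.1, by_contra fun h => hindep _ (h21 _ h) _ (h21 _ ht) (hC he), he⟩
  have hout : ∀ C ⊆ A, (∀ b ∈ T, ∃ e ∈ C, k e = b) → ∀ t ∉ V₂, ∃ v ∈ V₂, (t, v) ∈ C := by
    intro C hC hCT t ht
    obtain ⟨e, he, hke⟩ := hCT (.inr t) ⟨t, h21 t ht, .inr rfl⟩
    obtain rfl := (hk_out t (h21 t ht) e (hC he)).1 hke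
    exact ⟨e.2, by_contra fun h => hindep _ (h21 _ ht) _ (h21 _ h) (hC he), he⟩
  have hT₁ : ∀ b ∈ T, ∃ e ∈ A₁, k e = b := fun b hb => (hT b hb).1
  have hT₂ : ∀ b ∈ T, ∃ e ∈ A \ A₁, k e = b := fun b hb => (hT b hb).2
  exact ⟨A₁, A \ A₁, Finset.union_sdiff_of_subset hA₁, Finset.disjoint_sdiff,
    .of_lift hB₁ (hlift _ _ _ hPA₁) (hin _ hA₁ hT₁) (hout _ hA₁ hT₁),
    .of_lift hB₂ (hlift _ _ _ hPA₂) (hin _ Finset.sdiff_subset hT₂)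
      (hout _ Finset.sdiff_subset hT₂)⟩
end

section
/- Let D=(V1,V2;A) be a 2-arc-strong split digraph such that every vertex of V1 has out-degree at least 3 and in-degree at least 3 in D. If |V2| ≤ 3, then D has a strong arc decomposition. -/
open Relation in
/-- A binary relation `p` splits the arcs into two classes; if in each class every vertex
reaches and is reached from a common root, the classes form a strong arc decomposition. -/
theorem strongArcDecomp_of_rel {V : Type*} [DecidableEq V] {A : Finset (V × V)}
    (p : V → V → Prop) (r : V)
    (h₁ : ∀ x, ReflTransGen (fun u v => (u, v) ∈ A ∧ p u v) x r ∧
      ReflTransGen (fun u v => (u, v) ∈ A ∧ p u v) r x)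
    (h₂ : ∀ x, ReflTransGen (fun u v => (u, v) ∈ A ∧ ¬ p u v) x r ∧
      ReflTransGen (fun u v => (u, v) ∈ A ∧ ¬ p u v) r x) :
    StrongArcDecomp A := by
  classical
  refine ⟨A.filter fun e => p e.1 e.2, A.filter fun e => ¬ p e.1 e.2,
    Finset.filter_union_filter_not_eq _ A, Finset.disjoint_filter_filter_not A A _, ?_, ?_⟩
  · intro x y
    simpa only [Finset.mem_filter] using (h₁ x).1.trans (h₁ y).2
  · intro x y
    simpa only [Finset.mem_filter] using (h₂ x).1.trans (h₂ y).2

/-- If the out-neighbours of `t` lie in a set of at most `outDeg A t` vertices, then `t`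
dominates that whole set. -/
theorem mem_of_card_le_outDeg {V : Type*} [DecidableEq V] {A : Finset (V × V)} {S : Finset V}
    {t : V} (hS : ∀ x, (t, x) ∈ A → x ∈ S) (hcard : S.card ≤ outDeg A t) :
    ∀ x ∈ S, (t, x) ∈ A := by
  have hinj : Set.InjOn Prod.snd (A.filter fun e => e.1 = t : Set (V × V)) := by
    rintro ⟨a, b⟩ h ⟨c, d⟩ h' hbd
    simp_all
  have himage : (A.filter fun e => e.1 = t).image Prod.snd = S := by
    apply Finset.eq_of_subset_of_card_le
    · intro x hx
      simp only [Finset.mem_image, Finset.mem_filter, Prod.exists] at hx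
      grind
    · rwa [Finset.card_image_of_injOn (by simpa using hinj)]
  intro x hx
  rw [← himage] at hx
  simp only [Finset.mem_image, Finset.mem_filter, Prod.exists] at hx
  grind

/-- If the in-neighbours of `t` lie in a set of at most `inDeg A t` vertices, then `t`
is dominated by that whole set. -/
theorem mem_of_card_le_inDeg {V : Type*} [DecidableEq V] {A : Finset (V × V)} {S : Finset V}
    {t : V} (hS : ∀ x, (x, t) ∈ A → x ∈ S) (hcard : S.card ≤ inDeg A t) :
    ∀ x ∈ S, (x, t) ∈ A := by
  have hinj : Set.InjOn Prod.fst (A.filter fun e => e.2 = t : Set (V × V)) := by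
    rintro ⟨a, b⟩ h ⟨c, d⟩ h' hbd
    simp_all
  have himage : (A.filter fun e => e.2 = t).image Prod.fst = S := by
    apply Finset.eq_of_subset_of_card_le
    · intro x hx
      simp only [Finset.mem_image, Finset.mem_filter, Prod.exists] at hx
      grind
    · rwa [Finset.card_image_of_injOn (by simpa using hinj)]
  intro x hx
  rw [← himage] at hx
  simp only [Finset.mem_image, Finset.mem_filter, Prod.exists] at hx
  grind

theorem outDeg_le_card {V : Type*} [DecidableEq V] {A : Finset (V × V)} {S : Finset V}
    {t : V} (hS : ∀ x, (t, x) ∈ A → x ∈ S) : outDeg A t ≤ S.card := by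
  apply Finset.card_le_card_of_injOn Prod.snd
  · rintro ⟨a, b⟩ h
    simp only [Finset.coe_filter, Set.mem_ofPred_eq] at h
    exact hS b (h.2 ▸ h.1)
  · rintro ⟨a, b⟩ h ⟨c, d⟩ h' hbd
    simp_all

theorem ArcStrong.exists_in_arc_ne {V : Type*} [DecidableEq V] {A : Finset (V × V)}
    (h : ArcStrong 2 A) {s x : V} (hsx : (s, x) ∈ A) (hne : s ≠ x) :
    ∃ y, y ≠ s ∧ (y, x) ∈ A := by
  have hreach := h {(s, x)} (by simpa) (by simp) s x
  rcases hreach.cases_tail with heq | ⟨y, -, hy⟩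
  · exact absurd heq.symm hne
  · exact ⟨y, by grind, by grind⟩

theorem ArcStrong.exists_out_arc_ne {V : Type*} [DecidableEq V] {A : Finset (V × V)}
    (h : ArcStrong 2 A) {s x : V} (hxs : (x, s) ∈ A) (hne : s ≠ x) :
    ∃ y, y ≠ s ∧ (x, y) ∈ A := by
  have hreach := h {(x, s)} (by simpa) (by simp) x s
  rcases hreach.cases_head with heq | ⟨y, hy, -⟩
  · exact absurd heq.symm hne
  · exact ⟨y, by grind, by grind⟩

open Relation in
/-- A 3-cycle together with a vertex joined to it by all arcs in both directions decomposes. -/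
theorem strongArcDecomp_of_cycle {V : Type*} [DecidableEq V] {A : Finset (V × V)} {s a b c : V}
    (hall : ∀ x, x = s ∨ x = a ∨ x = b ∨ x = c)
    (hsa : s ≠ a) (hsb : s ≠ b) (hsc : s ≠ c) (hab : a ≠ b) (hac : a ≠ c) (hbc : b ≠ c)
    (hout : ∀ x, x ≠ s → (s, x) ∈ A) (hin : ∀ x, x ≠ s → (x, s) ∈ A)
    (h₁ : (a, b) ∈ A) (h₂ : (b, c) ∈ A) (h₃ : (c, a) ∈ A) :
    StrongArcDecomp A := by
  apply strongArcDecomp_of_rel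
    (fun u v => (u = s ∧ v = a) ∨ (u = a ∧ v = b) ∨ (u = b ∧ v = c) ∨ (u = c ∧ v = s)) s
  · set R : V → V → Prop := fun u v => (u, v) ∈ A ∧
      ((u = s ∧ v = a) ∨ (u = a ∧ v = b) ∨ (u = b ∧ v = c) ∨ (u = c ∧ v = s)) with hR
    have h_sa : ReflTransGen R s a := .single (by grind)
    have h_ab : ReflTransGen R a b := .single (by grind)
    have h_bc : ReflTransGen R b c := .single (by grind)
    have h_cs : ReflTransGen R c s := .single (by grind)
    intro x
    rcases hall x with rfl | rfl | rfl | rfl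
    · exact ⟨.refl, .refl⟩
    · exact ⟨h_ab.trans (h_bc.trans h_cs), h_sa⟩
    · exact ⟨h_bc.trans h_cs, h_sa.trans h_ab⟩
    · exact ⟨h_cs, h_sa.trans (h_ab.trans h_bc)⟩
  · set R : V → V → Prop := fun u v => (u, v) ∈ A ∧
      ¬ ((u = s ∧ v = a) ∨ (u = a ∧ v = b) ∨ (u = b ∧ v = c) ∨ (u = c ∧ v = s)) with hR
    have h_sb : ReflTransGen R s b := .single (by grind)
    have h_bs : ReflTransGen R b s := .single (by grind)
    have h_sc : ReflTransGen R s c := .single (by grind)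
    have h_ca : ReflTransGen R c a := .single (by grind)
    have h_as : ReflTransGen R a s := .single (by grind)
    intro x
    rcases hall x with rfl | rfl | rfl | rfl
    · exact ⟨.refl, .refl⟩
    · exact ⟨h_as, h_sc.trans h_ca⟩
    · exact ⟨h_bs, h_sb⟩
    · exact ⟨h_ca.trans h_as, h_sc⟩

open Relation in
/-- Two or more vertices joined by all arcs in both directions to three others decompose. -/
theorem strongArcDecomp_of_complete_bipartite {V : Type*} [DecidableEq V] {A : Finset (V × V)}
    {s t a b c : V} (hst : s ≠ t) (hab : a ≠ b) (hac : a ≠ c) (hbc : b ≠ c)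
    (hs : s ≠ a ∧ s ≠ b ∧ s ≠ c) (ht : t ≠ a ∧ t ≠ b ∧ t ≠ c)
    (hout : ∀ u, u ≠ a → u ≠ b → u ≠ c → (u, a) ∈ A ∧ (u, b) ∈ A ∧ (u, c) ∈ A)
    (hin : ∀ u, u ≠ a → u ≠ b → u ≠ c → (a, u) ∈ A ∧ (b, u) ∈ A ∧ (c, u) ∈ A) :
    StrongArcDecomp A := by
  apply strongArcDecomp_of_rel
    (fun u v => (u = a ∧ v ≠ s) ∨ (v = b ∧ u ≠ s) ∨ (u = s ∧ v = a) ∨ (u = b ∧ v = s) ∨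
      (u = s ∧ v = c) ∨ (u = c ∧ v = t)) s
  · set R : V → V → Prop := fun u v => (u, v) ∈ A ∧
      ((u = a ∧ v ≠ s) ∨ (v = b ∧ u ≠ s) ∨ (u = s ∧ v = a) ∨ (u = b ∧ v = s) ∨
        (u = s ∧ v = c) ∨ (u = c ∧ v = t)) with hR
    have h_sa : ReflTransGen R s a := .single (by grind)
    have h_at : ReflTransGen R a t := .single (by grind)
    have h_tb : ReflTransGen R t b := .single (by grind)
    have h_bs : ReflTransGen R b s := .single (by grind)
    have h_sc : ReflTransGen R s c := .single (by grind)
    have h_ct : ReflTransGen R c t := .single (by grind)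
    intro x
    by_cases hxa : x = a
    · subst hxa
      exact ⟨h_at.trans (h_tb.trans h_bs), h_sa⟩
    by_cases hxb : x = b
    · subst hxb
      exact ⟨h_bs, h_sa.trans (h_at.trans h_tb)⟩
    by_cases hxc : x = c
    · subst hxc
      exact ⟨h_ct.trans (h_tb.trans h_bs), h_sc⟩
    by_cases hxs : x = s
    · subst hxs
      exact ⟨.refl, .refl⟩
    have h_xb : ReflTransGen R x b := .single (by grind)
    have h_ax : ReflTransGen R a x := .single (by grind)
    exact ⟨h_xb.trans h_bs, h_sa.trans h_ax⟩
  · set R : V → V → Prop := fun u v => (u, v) ∈ A ∧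
      ¬ ((u = a ∧ v ≠ s) ∨ (v = b ∧ u ≠ s) ∨ (u = s ∧ v = a) ∨ (u = b ∧ v = s) ∨
        (u = s ∧ v = c) ∨ (u = c ∧ v = t)) with hR
    have h_as : ReflTransGen R a s := .single (by grind)
    have h_sb : ReflTransGen R s b := .single (by grind)
    have h_bt : ReflTransGen R b t := .single (by grind)
    have h_ta : ReflTransGen R t a := .single (by grind)
    have h_tc : ReflTransGen R t c := .single (by grind)
    have h_cs : ReflTransGen R c s := .single (by grind)
    intro x
    by_cases hxa : x = a
    · subst hxa
      exact ⟨h_as, h_sb.trans (h_bt.trans h_ta)⟩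
    by_cases hxb : x = b
    · subst hxb
      exact ⟨h_bt.trans (h_ta.trans h_as), h_sb⟩
    by_cases hxc : x = c
    · subst hxc
      exact ⟨h_cs, h_sb.trans (h_bt.trans h_tc)⟩
    by_cases hxs : x = s
    · subst hxs
      exact ⟨.refl, .refl⟩
    have h_xa : ReflTransGen R x a := .single (by grind)
    have h_bx : ReflTransGen R b x := .single (by grind)
    exact ⟨h_xa.trans h_as, h_sb.trans h_bx⟩

/-- Lemma 2.4 (i): a 2-arc-strong split digraph in which every vertex of `V₁` has
out- and in-degree at least 3 and `|V₂| ≤ 3` has a strong arc decomposition. -/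
theorem stmt4 {V : Type*} [Fintype V] [DecidableEq V]
    (V₁ V₂ : Finset V) (A : Finset (V × V))
    (hsplit : IsSplitDigraph V₁ V₂ A)
    (h2 : ArcStrong 2 A)
    (hdeg : ∀ t ∈ V₁, 3 ≤ outDeg A t ∧ 3 ≤ inDeg A t)
    (hV2 : V₂.card ≤ 3) :
    StrongArcDecomp A := by
  obtain ⟨⟨s, hs⟩, -, hdisj, hunion, hloop, hind, hsemi⟩ := hsplit
  have hmem : ∀ x, x ∈ V₁ ∨ x ∈ V₂ := fun x => by
    simpa using (hunion ▸ Finset.mem_univ x : x ∈ V₁ ∪ V₂)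
  have hnot : ∀ x ∈ V₁, x ∉ V₂ := fun x hx => Finset.disjoint_left.1 hdisj hx
  have hnbr_out : ∀ u ∈ V₁, ∀ x, (u, x) ∈ A → x ∈ V₂ := fun u hu x hux =>
    (hmem x).resolve_left fun hx => hind u hu x hx hux
  have hnbr_in : ∀ u ∈ V₁, ∀ x, (x, u) ∈ A → x ∈ V₂ := fun u hu x hxu =>
    (hmem x).resolve_left fun hx => hind x hx u hu hxu
  have hout : ∀ u ∈ V₁, ∀ x ∈ V₂, (u, x) ∈ A := fun u hu =>
    mem_of_card_le_outDeg (hnbr_out u hu) (hV2.trans (hdeg u hu).1)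
  have hin : ∀ u ∈ V₁, ∀ x ∈ V₂, (x, u) ∈ A := fun u hu =>
    mem_of_card_le_inDeg (hnbr_in u hu) (hV2.trans (hdeg u hu).2)
  have hcard : V₂.card = 3 :=
    le_antisymm hV2 ((hdeg s hs).1.trans (outDeg_le_card (hnbr_out s hs)))
  obtain ⟨a, b, c, hab, hac, hbc, rfl⟩ := Finset.card_eq_three.1 hcard
  simp only [Finset.mem_insert, Finset.mem_singleton] at *
  by_cases htwo : ∃ t ∈ V₁, s ≠ t
  · obtain ⟨t, ht, hst⟩ := htwo
    exact strongArcDecomp_of_complete_bipartite hst hab hac hbc (by grind) (by grind)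
      (by grind) (by grind)
  · push Not at htwo
    have hall : ∀ x, x = s ∨ x = a ∨ x = b ∨ x = c := fun x =>
      (hmem x).imp_left fun hx => (htwo x hx).symm
    have hsa : s ≠ a := by grind
    have hsb : s ≠ b := by grind
    have hsc : s ≠ c := by grind
    have hso : ∀ x, x ≠ s → (s, x) ∈ A := by grind
    have hsi : ∀ x, x ≠ s → (x, s) ∈ A := by grind
    have in_arc : ∀ x, x ≠ s → (a ≠ x ∧ (a, x) ∈ A) ∨ (b ≠ x ∧ (b, x) ∈ A) ∨
        (c ≠ x ∧ (c, x) ∈ A) := fun x hx => by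
      obtain ⟨y, hys, hyx⟩ := h2.exists_in_arc_ne (hso x hx) hx.symm
      have hne : y ≠ x := fun h => hloop x (h ▸ hyx)
      rcases hall y with rfl | rfl | rfl | rfl <;> tauto
    have out_arc : ∀ x, x ≠ s → (a ≠ x ∧ (x, a) ∈ A) ∨ (b ≠ x ∧ (x, b) ∈ A) ∨
        (c ≠ x ∧ (x, c) ∈ A) := fun x hx => by
      obtain ⟨y, hys, hxy⟩ := h2.exists_out_arc_ne (hsi x hx) hx.symm
      have hne : y ≠ x := fun h => hloop x (h ▸ hxy)
      rcases hall y with rfl | rfl | rfl | rfl <;> tauto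
    have ia := in_arc a hsa.symm
    have ib := in_arc b hsb.symm
    have ic := in_arc c hsc.symm
    have oa := out_arc a hsa.symm
    have ob := out_arc b hsb.symm
    have oc := out_arc c hsc.symm
    have hsab := hsemi a (by simp) b (by simp) hab
    have hsac := hsemi a (by simp) c (by simp) hac
    have hsbc := hsemi b (by simp) c (by simp) hbc
    have hcycle : ((a, b) ∈ A ∧ (b, c) ∈ A ∧ (c, a) ∈ A) ∨
        ((a, c) ∈ A ∧ (c, b) ∈ A ∧ (b, a) ∈ A) := by
      clear hnbr_out hnbr_in hout hin in_arc out_arc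
      grind
    rcases hcycle with ⟨h₁, h₂, h₃⟩ | ⟨h₁, h₂, h₃⟩
    · exact strongArcDecomp_of_cycle hall hsa hsb hsc hab hac hbc hso hsi h₁ h₂ h₃
    · exact strongArcDecomp_of_cycle (fun x => (hall x).imp_right (Or.imp_right Or.symm)) hsa hsc hsb hac
        hab hbc.symm hso hsi h₁ h₂ h₃
end

section
/- Let D=(V1,V2;A) be a split digraph such that every vertex of V1 has out-degree at least 3 and in-degree at least 3 in D. If the subdigraph of D induced by V2 is isomorphic to S4, then D has a strong arc decomposition. -/
/-- The arc set of the digraph `S₄` on vertices `0,1,2,3` (standing for `v₁,v₂,v₃,v₄`). -/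
def S4Arcs : Finset (Fin 4 × Fin 4) :=
  {(0, 1), (1, 2), (2, 3), (3, 0), (0, 2), (2, 0), (1, 3), (3, 1)}

/-- A digraph is strong as soon as no proper nonempty vertex set is closed under
following arcs. -/
theorem DigraphStrong.of_closed {V : Type*} [Fintype V] {A : Finset (V × V)}
    (h : ∀ S : Finset V, S.Nonempty → (∀ e ∈ A, e.1 ∈ S → e.2 ∈ S) → S = Finset.univ) :
    DigraphStrong A := by
  classical
  intro x y
  have hS := h (Finset.univ.filter fun z => Relation.ReflTransGen (fun a b => (a, b) ∈ A) x z)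
    ⟨x, by simp [Relation.ReflTransGen.refl]⟩
    (fun e he hx => by
      simp only [Finset.mem_filter, Finset.mem_univ, true_and] at hx ⊢
      exact hx.tail he)
  have hy := Finset.mem_univ y
  rw [← hS] at hy
  simpa using hy

/-- If the image of a strong digraph lies in `A`, and every other vertex has an in-neighbour
and an out-neighbour in this image, then `A` is strong. -/
theorem DigraphStrong.extend {V W : Type*} {A : Finset (V × V)} {B : Finset (W × W)}
    (hB : DigraphStrong B) (φ : W → V) (hφ : ∀ e ∈ B, (φ e.1, φ e.2) ∈ A)
    (hout : ∀ s ∉ Set.range φ, ∃ x, (s, φ x) ∈ A)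
    (hin : ∀ s ∉ Set.range φ, ∃ x, (φ x, s) ∈ A) :
    DigraphStrong A := by
  have core : ∀ x y, Relation.ReflTransGen (fun a b => (a, b) ∈ A) (φ x) (φ y) :=
    fun x y => (hB x y).lift φ fun a b hab => hφ (a, b) hab
  have source : ∀ u, ∃ x, Relation.ReflTransGen (fun a b => (a, b) ∈ A) u (φ x) := by
    intro u
    by_cases hu : u ∈ Set.range φ
    · obtain ⟨x, rfl⟩ := hu
      exact ⟨x, .refl⟩
    · exact (hout u hu).imp fun x hx => .single hx
  have target : ∀ v, ∃ y, Relation.ReflTransGen (fun a b => (a, b) ∈ A) (φ y) v := by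
    intro v
    by_cases hv : v ∈ Set.range φ
    · obtain ⟨y, rfl⟩ := hv
      exact ⟨y, .refl⟩
    · exact (hin v hv).imp fun y hy => .single hy
  intro u v
  obtain ⟨x, hx⟩ := source u
  obtain ⟨y, hy⟩ := target v
  exact (hx.trans (core x y)).trans hy

/-- A strong arc decomposition of a subdigraph extends to the whole digraph when every
other vertex has two in-neighbours and two out-neighbours in the subdigraph. -/
theorem StrongArcDecomp.extend {V W : Type*} [DecidableEq V] [DecidableEq W] [Nonempty W]
    {A : Finset (V × V)} {B : Finset (W × W)} (hB : StrongArcDecomp B)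
    (φ : W → V) (hinj : Function.Injective φ) (hφ : ∀ e ∈ B, (φ e.1, φ e.2) ∈ A)
    (hout : ∀ s ∉ Set.range φ, ∃ x y, x ≠ y ∧ (s, φ x) ∈ A ∧ (s, φ y) ∈ A)
    (hin : ∀ s ∉ Set.range φ, ∃ x y, x ≠ y ∧ (φ x, s) ∈ A ∧ (φ y, s) ∈ A) :
    StrongArcDecomp A := by
  classical
  obtain ⟨B₁, B₂, rfl, hdisj, hB₁, hB₂⟩ := hB
  choose! q q' hq hqA hqA' using hout
  choose! p p' hp hpA hpA' using hin
  have hne : ∀ s ∉ Set.range φ, ∀ x, φ x ≠ s := fun s hs x hx => hs ⟨x, hx⟩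
  let A₁ := A.filter fun e =>
    (∃ d ∈ B₁, (φ d.1, φ d.2) = e) ∨ (∃ s ∉ Set.range φ, (s, φ (q s)) = e) ∨
      ∃ s ∉ Set.range φ, (φ (p s), s) = e
  refine ⟨A₁, A \ A₁, Finset.union_sdiff_of_subset (Finset.filter_subset _ _),
    Finset.disjoint_sdiff, hB₁.extend φ ?_ ?_ ?_, hB₂.extend φ ?_ ?_ ?_⟩
  · intro e he
    exact Finset.mem_filter.2 ⟨hφ e (Finset.mem_union_left _ he), .inl ⟨e, he, rfl⟩⟩
  · intro s hs
    exact ⟨q s, Finset.mem_filter.2 ⟨hqA s hs, .inr (.inl ⟨s, hs, rfl⟩)⟩⟩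
  · intro s hs
    exact ⟨p s, Finset.mem_filter.2 ⟨hpA s hs, .inr (.inr ⟨s, hs, rfl⟩)⟩⟩
  · intro e he
    refine Finset.mem_sdiff.2 ⟨hφ e (Finset.mem_union_right _ he), fun h => ?_⟩
    rcases (Finset.mem_filter.1 h).2 with ⟨d, hd, hde⟩ | ⟨s, hs, hse⟩ | ⟨s, hs, hse⟩
    · have hde : d = e := Prod.ext (hinj (Prod.mk.inj hde).1) (hinj (Prod.mk.inj hde).2)
      exact Finset.disjoint_left.1 hdisj hd (hde ▸ he)
    · exact hne s hs _ (Prod.mk.inj hse).1.symm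
    · exact hne s hs _ (Prod.mk.inj hse).2.symm
  · intro s hs
    refine ⟨q' s, Finset.mem_sdiff.2 ⟨hqA' s hs, fun h => ?_⟩⟩
    rcases (Finset.mem_filter.1 h).2 with ⟨d, -, hde⟩ | ⟨r, -, hre⟩ | ⟨r, hr, hre⟩
    · exact hne s hs _ (Prod.mk.inj hde).1
    · obtain ⟨rfl, h₂⟩ := Prod.mk.inj hre
      exact hq r hs (hinj h₂)
    · exact hne r hr _ (Prod.mk.inj hre).2.symm
  · intro s hs
    refine ⟨p' s, Finset.mem_sdiff.2 ⟨hpA' s hs, fun h => ?_⟩⟩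
    rcases (Finset.mem_filter.1 h).2 with ⟨d, -, hde⟩ | ⟨r, hr, hre⟩ | ⟨r, -, hre⟩
    · exact hne s hs _ (Prod.mk.inj hde).2
    · exact hne r hr _ (Prod.mk.inj hre).1.symm
    · obtain ⟨h₁, rfl⟩ := Prod.mk.inj hre
      exact hp r hs (hinj h₁)

/-- The arcs of `S₄` with an extra vertex `none`, which has arcs to all vertices of `S₄`
but `a` and from all vertices of `S₄` but `b`. -/
def S4ConeArcs (a b : Fin 4) : Finset (Option (Fin 4) × Option (Fin 4)) :=
  S4Arcs.image (Prod.map some some) ∪ (Finset.univ.erase a).image (fun i => (none, some i)) ∪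
    (Finset.univ.erase b).image fun i => (some i, none)

/-- A Hamiltonian cycle of `S4ConeArcs a b` whose removal leaves a strong digraph. -/
def S4ConeCycle (a b : Fin 4) : Finset (Option (Fin 4) × Option (Fin 4)) :=
  if b = a + 2 then
    {(some a, some (a + 1)), (some (a + 1), none), (none, some (a + 2)),
      (some (a + 2), some (a + 3)), (some (a + 3), some a)}
  else
    {(some a, some (a + 1)), (some (a + 1), some (a + 2)), (some (a + 2), none),
      (none, some (a + 3)), (some (a + 3), some a)}

theorem strongArcDecomp_S4ConeArcs (a b : Fin 4) : StrongArcDecomp (S4ConeArcs a b) := by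
  refine ⟨S4ConeCycle a b, S4ConeArcs a b \ S4ConeCycle a b,
    Finset.union_sdiff_of_subset ?_, Finset.disjoint_sdiff, .of_closed ?_, .of_closed ?_⟩
  · revert a b
    decide +kernel
  · revert a b
    decide +kernel
  · revert a b
    decide +kernel

theorem exists_forall_ne_mem {α : Type*} [DecidableEq α] {n : ℕ} [NeZero n] (g : Fin n → α)
    (F : Finset α) (hF : F ⊆ Finset.univ.image g) (hcard : n ≤ F.card + 1) :
    ∃ a, ∀ i ≠ a, g i ∈ F := by
  have h₁ : F ⊆ (Finset.univ.filter fun i => g i ∈ F).image g := by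
    intro x hx
    obtain ⟨i, -, rfl⟩ := Finset.mem_image.1 (hF hx)
    exact Finset.mem_image_of_mem g (by simpa using hx)
  have h₂ := (Finset.card_le_card h₁).trans Finset.card_image_le
  have h₃ := Finset.card_filter_add_card_filter_not (s := (Finset.univ : Finset (Fin n)))
    fun i => g i ∈ F
  rw [Finset.card_univ, Fintype.card_fin] at h₃
  obtain ⟨a, ha⟩ := Finset.card_le_one_iff_subset_singleton.1
    (show (Finset.univ.filter fun i => g i ∉ F).card ≤ 1 by omega)
  refine ⟨a, fun i hi => by_contra fun h => hi ?_⟩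
  simpa using ha (Finset.mem_filter.2 ⟨Finset.mem_univ i, h⟩)

/-- Lemma 2.4 (ii): a split digraph in which every vertex of `V₁` has out- and
in-degree at least 3 and whose semicomplete part induces a digraph isomorphic to `S₄`
has a strong arc decomposition. -/
theorem stmt5 {V : Type*} [Fintype V] [DecidableEq V]
    (V₁ V₂ : Finset V) (A : Finset (V × V))
    (hsplit : IsSplitDigraph V₁ V₂ A)
    (hdeg : ∀ t ∈ V₁, 3 ≤ outDeg A t ∧ 3 ≤ inDeg A t)
    (hiso : ∃ f : V → Fin 4, Set.BijOn f ↑V₂ Set.univ ∧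
      ∀ u ∈ V₂, ∀ v ∈ V₂, ((u, v) ∈ A ↔ (f u, f v) ∈ S4Arcs)) :
    StrongArcDecomp A := by
  obtain ⟨⟨t, ht⟩, -, hdisj, hunion, -, hindep, -⟩ := hsplit
  obtain ⟨f, hf, hfA⟩ := hiso
  choose e he hfe using fun i => hf.surjOn (Set.mem_univ i)
  have hV₂ : ∀ v ∉ V₁, ∃ i, e i = v := by
    intro v hv
    have hv₂ : v ∈ V₂ := by
      have := Finset.mem_univ v
      rw [← hunion, Finset.mem_union] at this
      exact this.resolve_left hv
    exact ⟨f v, hf.injOn (he _) hv₂ (hfe _)⟩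
  have hout : ∀ s ∈ V₁, ∃ a, ∀ i ≠ a, (s, e i) ∈ A := by
    intro s hs
    obtain ⟨a, ha⟩ := exists_forall_ne_mem (fun i => (s, e i)) (A.filter fun d => d.1 = s)
      (by
        rintro ⟨u, v⟩ hd
        obtain ⟨hA, h⟩ := Finset.mem_filter.1 hd
        dsimp only at h
        subst h
        obtain ⟨i, rfl⟩ := hV₂ v fun hv => hindep _ hs v hv hA
        simp)
      (Nat.succ_le_succ (hdeg s hs).1)
    exact ⟨a, fun i hi => (Finset.mem_filter.1 (ha i hi)).1⟩
  have hin : ∀ s ∈ V₁, ∃ b, ∀ i ≠ b, (e i, s) ∈ A := by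
    intro s hs
    obtain ⟨b, hb⟩ := exists_forall_ne_mem (fun i => (e i, s)) (A.filter fun d => d.2 = s)
      (by
        rintro ⟨u, v⟩ hd
        obtain ⟨hA, h⟩ := Finset.mem_filter.1 hd
        dsimp only at h
        subst h
        obtain ⟨i, rfl⟩ := hV₂ u fun hu => hindep u hu _ hs hA
        simp)
      (Nat.succ_le_succ (hdeg s hs).2)
    exact ⟨b, fun i hi => (Finset.mem_filter.1 (hb i hi)).1⟩
  obtain ⟨a, ha⟩ := hout t ht
  obtain ⟨b, hb⟩ := hin t ht
  let φ : Option (Fin 4) → V := fun o => o.elim t e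
  have hrange : ∀ s ∉ Set.range φ, s ∈ V₁ := by
    intro s hs
    by_contra h
    obtain ⟨i, rfl⟩ := hV₂ s h
    exact hs ⟨some i, rfl⟩
  have hte : ∀ i, t ≠ e i := fun i h => Finset.disjoint_left.1 hdisj ht (h ▸ he i)
  have hshift : ∀ c : Fin 4, c + 1 ≠ c ∧ c + 2 ≠ c ∧ c + 1 ≠ c + 2 := by decide
  refine (strongArcDecomp_S4ConeArcs a b).extend φ ?_ ?_ ?_ ?_
  · rintro (_ | i) (_ | j) h
    · rfl
    · exact (hte j h).elim
    · exact (hte i h.symm).elim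
    · exact congrArg some ((hfe i).symm.trans ((congrArg f h).trans (hfe j)))
  · intro d hd
    simp only [S4ConeArcs, Finset.mem_union, Finset.mem_image, Finset.mem_erase,
      Finset.mem_univ, and_true] at hd
    rcases hd with (⟨⟨i, j⟩, h, rfl⟩ | ⟨i, hi, rfl⟩) | ⟨i, hi, rfl⟩
    · exact (hfA _ (he i) _ (he j)).2 (by rwa [hfe, hfe])
    · exact ha i hi
    · exact hb i hi
  · intro s hs
    obtain ⟨c, hc⟩ := hout s (hrange s hs)
    obtain ⟨h₁, h₂, h₃⟩ := hshift c
    exact ⟨some (c + 1), some (c + 2), fun h => h₃ (Option.some.inj h), hc _ h₁, hc _ h₂⟩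
  · intro s hs
    obtain ⟨c, hc⟩ := hin s (hrange s hs)
    obtain ⟨h₁, h₂, h₃⟩ := hshift c
    exact ⟨some (c + 1), some (c + 2), fun h => h₃ (Option.some.inj h), hc _ h₁, hc _ h₂⟩
end

section
/- Let D=(V1,V2;A) be a split digraph such that every vertex of V1 has out-degree at least 3 and in-degree at least 3 in D, and let D* be any directed multigraph obtained from D by splitting off some pairs at vertices of V1. If D*⟨V2⟩ is isomorphic to one of the directed multigraphs S4, S4,1, S4,2 or S4,3, then D has a strong arc decomposition. -/
/-- The arc multiset of the directed multigraph `S₄` on vertices `0,1,2,3`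
(standing for `v₁,v₂,v₃,v₄`). -/
def S4M : Multiset (Fin 4 × Fin 4) :=
  {(0, 1), (1, 2), (2, 3), (3, 0), (0, 2), (2, 0), (1, 3), (3, 1)}

/-- `S₄,₁`: `S₄` with a second parallel copy of the arc `v₃v₁`. -/
def S41M : Multiset (Fin 4 × Fin 4) := (2, 0) ::ₘ S4M

/-- `S₄,₂`: `S₄` with a second parallel copy of the arc `v₁v₂`. -/
def S42M : Multiset (Fin 4 × Fin 4) := (0, 1) ::ₘ S4M

/-- `S₄,₃`: `S₄` with second parallel copies of the arcs `v₃v₁` and `v₂v₄`. -/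
def S43M : Multiset (Fin 4 × Fin 4) := (2, 0) ::ₘ (1, 3) ::ₘ S4M

/-- The list of arcs traversed by a walk. -/
def walkArcs {α : Type*} (l : List α) : List (α × α) := l.zip l.tail

theorem mem_walkArcs_cons {α : Type*} {a b : α} {l : List α} {e : α × α}
    (he : e ∈ walkArcs (b :: l)) : e ∈ walkArcs (a :: b :: l) := by
  simp only [walkArcs, List.tail_cons, List.zip_cons_cons, List.mem_cons] at he ⊢
  exact Or.inr he

theorem reflTransGen_of_mem_walk {α : Type*} {R : α → α → Prop} {a z : α} {l : List α}
    (hR : ∀ e ∈ walkArcs (a :: l), R e.1 e.2) (hz : (a :: l).getLast? = some z) :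
    ∀ x ∈ a :: l, Relation.ReflTransGen R a x ∧ Relation.ReflTransGen R x z := by
  induction l generalizing a with
  | nil =>
    intro x hx
    obtain rfl : a = z := by simpa using hz
    obtain rfl : x = a := by simpa using hx
    exact ⟨.refl, .refl⟩
  | cons b l ih =>
    have hab : R a b := hR (a, b) (by simp [walkArcs])
    have ih := ih (fun e he => hR e (mem_walkArcs_cons he)) (by simpa using hz)
    intro x hx
    rcases List.mem_cons.1 hx with rfl | hx
    · exact ⟨.refl, .head hab (ih b (by simp)).2⟩
    · exact ⟨.head hab (ih x hx).1, (ih x hx).2⟩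

/-- A closed walk visiting every element of `α`. -/
def IsClosedSpanningWalk {α : Type*} (l : List α) : Prop :=
  l.head? = l.getLast? ∧ ∀ x, x ∈ l

instance {α : Type*} [Fintype α] [DecidableEq α] (l : List α) :
    Decidable (IsClosedSpanningWalk l) :=
  inferInstanceAs (Decidable (_ ∧ _))

theorem IsClosedSpanningWalk.reflTransGen {α : Type*} {R : α → α → Prop} {l : List α}
    (hl : IsClosedSpanningWalk l) (hR : ∀ e ∈ walkArcs l, R e.1 e.2) (x y : α) :
    Relation.ReflTransGen R x y := by
  obtain ⟨hc, hs⟩ := hl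
  cases l with
  | nil => exact absurd (hs x) (by simp)
  | cons a l =>
    have h := reflTransGen_of_mem_walk hR (z := a) (by rw [← hc]; rfl)
    exact (h x (hs x)).2.trans (h y (hs y)).1

theorem digraphStrong_of_closedWalk {V ι : Type*} {B : Finset (V × V)} {φ : ι → V} {l : List ι}
    (hl : IsClosedSpanningWalk l) (hB : ∀ e ∈ walkArcs l, (φ e.1, φ e.2) ∈ B)
    (hin : ∀ v ∉ Set.range φ, ∃ i, (φ i, v) ∈ B) (hout : ∀ v ∉ Set.range φ, ∃ i, (v, φ i) ∈ B) :
    DigraphStrong B := by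
  intro x y
  have hx : ∃ i, Relation.ReflTransGen (fun a b => (a, b) ∈ B) x (φ i) := by
    by_cases h : x ∈ Set.range φ
    · obtain ⟨i, rfl⟩ := h
      exact ⟨i, .refl⟩
    · obtain ⟨i, hi⟩ := hout x h
      exact ⟨i, .single hi⟩
  have hy : ∃ i, Relation.ReflTransGen (fun a b => (a, b) ∈ B) (φ i) y := by
    by_cases h : y ∈ Set.range φ
    · obtain ⟨i, rfl⟩ := h
      exact ⟨i, .refl⟩
    · obtain ⟨i, hi⟩ := hin y h
      exact ⟨i, .single hi⟩
  obtain ⟨i, hi⟩ := hx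
  obtain ⟨j, hj⟩ := hy
  have hij := hl.reflTransGen (R := fun i j => (φ i, φ j) ∈ B) hB i j
  exact hi.trans ((hij.lift φ fun _ _ h => h).trans hj)

/-- Two arc-disjoint closed walks spanning the image of `φ` give a strong arc decomposition
when every other vertex has two in-neighbours and two out-neighbours in that image. -/
theorem strongArcDecomp_of_closedWalks {V ι : Type*} [DecidableEq V] [Nonempty ι]
    {A : Finset (V × V)} {φ : ι → V} (hφ : Function.Injective φ) {l₁ l₂ : List ι}
    (h₁ : IsClosedSpanningWalk l₁) (h₂ : IsClosedSpanningWalk l₂)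
    (hA₁ : ∀ e ∈ walkArcs l₁, (φ e.1, φ e.2) ∈ A) (hA₂ : ∀ e ∈ walkArcs l₂, (φ e.1, φ e.2) ∈ A)
    (hd : ∀ e ∈ walkArcs l₂, e ∉ walkArcs l₁)
    (hin : ∀ v ∉ Set.range φ, ∃ i j, i ≠ j ∧ (φ i, v) ∈ A ∧ (φ j, v) ∈ A)
    (hout : ∀ v ∉ Set.range φ, ∃ i j, i ≠ j ∧ (v, φ i) ∈ A ∧ (v, φ j) ∈ A) :
    StrongArcDecomp A := by
  classical
  choose! a a' haa ha ha' using hin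
  choose! c c' hcc hc hc' using hout
  let P : V × V → Prop := fun e =>
    (∃ w ∈ walkArcs l₁, (φ w.1, φ w.2) = e) ∨ (e.2 ∉ Set.range φ ∧ e.1 = φ (a e.2)) ∨
      (e.1 ∉ Set.range φ ∧ e.2 = φ (c e.1))
  refine ⟨A.filter P, A.filter fun e => ¬ P e, Finset.filter_union_filter_not_eq _ _,
    Finset.disjoint_filter_filter_not _ _ _, ?_, ?_⟩
  · refine digraphStrong_of_closedWalk (φ := φ) h₁ (fun e he => ?_) (fun v hv => ⟨a v, ?_⟩)
      (fun v hv => ⟨c v, ?_⟩)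
    · exact Finset.mem_filter.2 ⟨hA₁ e he, Or.inl ⟨e, he, rfl⟩⟩
    · exact Finset.mem_filter.2 ⟨ha v hv, Or.inr (Or.inl ⟨hv, rfl⟩)⟩
    · exact Finset.mem_filter.2 ⟨hc v hv, Or.inr (Or.inr ⟨hv, rfl⟩)⟩
  · refine digraphStrong_of_closedWalk (φ := φ) h₂ (fun e he => ?_) (fun v hv => ⟨a' v, ?_⟩)
      (fun v hv => ⟨c' v, ?_⟩)
    · refine Finset.mem_filter.2 ⟨hA₂ e he, ?_⟩
      rintro (⟨w, hw, hwe⟩ | ⟨h, -⟩ | ⟨h, -⟩)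
      · obtain ⟨h1, h2⟩ := Prod.mk.inj hwe
        obtain rfl : w = e := Prod.ext (hφ h1) (hφ h2)
        exact hd w he hw
      · exact h ⟨_, rfl⟩
      · exact h ⟨_, rfl⟩
    · refine Finset.mem_filter.2 ⟨ha' v hv, ?_⟩
      rintro (⟨w, hw, hwe⟩ | ⟨-, h⟩ | ⟨h, -⟩)
      · exact hv ⟨_, (Prod.mk.inj hwe).2⟩
      · exact haa v hv (hφ h).symm
      · exact h ⟨_, rfl⟩
    · refine Finset.mem_filter.2 ⟨hc' v hv, ?_⟩
      rintro (⟨w, hw, hwe⟩ | ⟨h, -⟩ | ⟨-, h⟩)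
      · exact hv ⟨_, (Prod.mk.inj hwe).1⟩
      · exact h ⟨_, rfl⟩
      · exact hcc v hv (hφ h).symm

/-- The digraph on `Fin 4 ⊕ Fin k` consisting of the 4-cycle `0123`, its diagonals `(i, i + 2)`
except those with `i` in some `K t`, and for each `t : Fin k` a vertex with an arc from every
`i ≠ p t` and to every `j ≠ q t`, which moreover is the midpoint of a path replacing the
diagonal `(i, i + 2)` for each `i` in `K t`. -/
def splitModel {k : ℕ} (K : Fin k → List (Fin 4)) (p q : Fin k → Fin 4) :
    Fin 4 ⊕ Fin k → Fin 4 ⊕ Fin k → Prop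
  | .inl i, .inl j => j = i + 1 ∨ j = i + 2 ∧ ∀ t, i ∉ K t
  | .inl i, .inr t => i ≠ p t ∨ i ∈ K t
  | .inr t, .inl j => j ≠ q t ∨ j + 2 ∈ K t
  | .inr _, .inr _ => False

instance {k : ℕ} (K : Fin k → List (Fin 4)) (p q : Fin k → Fin 4) :
    ∀ x y, Decidable (splitModel K p q x y)
  | .inl _, .inl _ => inferInstanceAs (Decidable (_ ∨ _))
  | .inl _, .inr _ => inferInstanceAs (Decidable (_ ∨ _))
  | .inr _, .inl _ => inferInstanceAs (Decidable (_ ∨ _))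
  | .inr _, .inr _ => inferInstanceAs (Decidable False)

/-- The pair of walks `w` consists of arc-disjoint closed spanning walks. -/
def IsDisjointWalkPair {α : Type*} (w : List α × List α) : Prop :=
  IsClosedSpanningWalk w.1 ∧ IsClosedSpanningWalk w.2 ∧ ∀ e ∈ walkArcs w.2, e ∉ walkArcs w.1

instance {α : Type*} [Fintype α] [DecidableEq α] (w : List α × List α) :
    Decidable (IsDisjointWalkPair w) :=
  inferInstanceAs (Decidable (_ ∧ _ ∧ _))

/-- A pair of lists of numbers, with `4 + t` standing for the vertex `Sum.inr t`, read as a pair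
of walks on `Fin 4 ⊕ Fin k`. -/
def readWalks {k : ℕ} (w : List (Fin (4 + k)) × List (Fin (4 + k))) :
    List (Fin 4 ⊕ Fin k) × List (Fin 4 ⊕ Fin k) :=
  (w.1.map finSumFinEquiv.symm, w.2.map finSumFinEquiv.symm)

/-- Every digraph `splitModel K p q` contains two arc-disjoint closed spanning walks. -/
def ModelDecomposes {k : ℕ} (K : Fin k → List (Fin 4)) : Prop :=
  ∀ p q : Fin k → Fin 4, ∃ w : List (Fin 4 ⊕ Fin k) × List (Fin 4 ⊕ Fin k),
    IsDisjointWalkPair w ∧ ∀ e ∈ walkArcs w.1 ++ walkArcs w.2, splitModel K p q e.1 e.2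

theorem ModelDecomposes.of_list {k : ℕ} {K : Fin k → List (Fin 4)}
    (P : List (List (Fin (4 + k)) × List (Fin (4 + k))))
    (hP : ∀ w ∈ P, IsDisjointWalkPair (readWalks w))
    (h : ∀ p q : Fin k → Fin 4, ∃ w ∈ P,
      ∀ e ∈ walkArcs (readWalks w).1 ++ walkArcs (readWalks w).2, splitModel K p q e.1 e.2) :
    ModelDecomposes K := by
  intro p q
  obtain ⟨w, hw, hwe⟩ := h p q
  exact ⟨readWalks w, hP w hw, hwe⟩

theorem modelDecomposes_none : ModelDecomposes ![([] : List (Fin 4))] :=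
  .of_list
    [([0, 2, 4, 1, 3, 0], [0, 1, 4, 2, 3, 1, 4, 2, 0]),
     ([0, 1, 3, 4, 2, 3, 0], [0, 4, 3, 1, 2, 0]),
     ([0, 2, 3, 1, 4, 0], [0, 1, 2, 4, 3, 0]),
     ([0, 1, 2, 3, 4, 0], [0, 2, 0, 4, 1, 3, 0])]
    (by decide +kernel) (by decide +kernel)

theorem modelDecomposes_one : ModelDecomposes ![([0] : List (Fin 4))] :=
  .of_list
    [([0, 4, 1, 2, 3, 0], [0, 1, 3, 4, 2, 0]),
     ([0, 1, 4, 2, 3, 0], [0, 4, 3, 1, 2, 0]),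
     ([0, 1, 3, 4, 2, 3, 4, 0], [0, 4, 3, 1, 2, 0]),
     ([0, 1, 2, 3, 1, 4, 0], [0, 4, 1, 3, 0, 4, 2, 0])]
    (by decide +kernel) (by decide +kernel)

theorem modelDecomposes_same : ModelDecomposes ![([0, 1] : List (Fin 4))] :=
  .of_list [([0, 1, 4, 2, 3, 0], [0, 4, 3, 1, 2, 0])] (by decide +kernel) (by decide +kernel)

theorem modelDecomposes_two : ModelDecomposes ![([0] : List (Fin 4)), [1]] :=
  .of_list
    [([0, 4, 2, 3, 1, 5, 0], [0, 1, 2, 4, 1, 2, 5, 3, 0]),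
     ([0, 4, 3, 5, 1, 2, 0], [0, 1, 4, 2, 3, 0, 1, 5, 3, 0]),
     ([0, 1, 5, 2, 3, 4, 0], [0, 4, 2, 0, 5, 3, 1, 2, 0]),
     ([0, 1, 5, 2, 3, 0, 1, 5, 2, 4, 0], [0, 4, 2, 5, 3, 1, 2, 0]),
     ([0, 4, 2, 3, 1, 5, 0], [0, 5, 3, 4, 1, 2, 0]),
     ([0, 4, 1, 5, 2, 3, 0], [0, 5, 3, 1, 2, 4, 2, 0]),
     ([0, 4, 2, 3, 1, 5, 0], [0, 1, 2, 5, 3, 4, 0]),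
     ([0, 1, 5, 0, 4, 2, 3, 0], [0, 5, 3, 1, 2, 4, 0]),
     ([0, 4, 1, 5, 2, 3, 0], [0, 1, 2, 5, 3, 4, 2, 0])]
    (by decide +kernel) (by decide +kernel)

/-- The vertices `g 0, …, g 3` carry the 4-cycle and at least one arc of each diagonal, every
missing diagonal arc is replaced by a path through one outer vertex, outer vertices have at most
one non-in-neighbour and one non-out-neighbour among the `g i`, and there is an outer vertex. -/
structure CycleConfig {V : Type*} (A : Finset (V × V)) (g : Fin 4 → V) : Prop where
  inj : Function.Injective g
  cycle : ∀ i, (g i, g (i + 1)) ∈ A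
  diag : ∀ i, (g i, g (i + 2)) ∈ A ∨ (g (i + 2), g i) ∈ A
  split : ∀ i, (g i, g (i + 2)) ∉ A →
    ∃ t ∉ Set.range g, (g i, t) ∈ A ∧ (t, g (i + 2)) ∈ A
  inNbr : ∀ t ∉ Set.range g, ∃ m, ∀ j ≠ m, (g j, t) ∈ A
  outNbr : ∀ t ∉ Set.range g, ∃ m, ∀ j ≠ m, (t, g j) ∈ A
  outer : ∃ t, t ∉ Set.range g

namespace CycleConfig

variable {V : Type*} {A : Finset (V × V)} {g : Fin 4 → V}

theorem rotate (h : CycleConfig A g) (r : Fin 4) : CycleConfig A fun i => g (i + r) := by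
  have hr : Set.range (fun i => g (i + r)) = Set.range g :=
    (Equiv.addRight r).surjective.range_comp g
  refine ⟨h.inj.comp (Equiv.addRight r).injective, fun i => ?_, fun i => ?_, fun i => ?_,
    ?_, ?_, ?_⟩
  · simpa only [add_right_comm] using h.cycle (i + r)
  · simpa only [add_right_comm] using h.diag (i + r)
  · simpa only [add_right_comm, hr] using h.split (i + r)
  · intro t ht
    obtain ⟨m, hm⟩ := h.inNbr t (hr ▸ ht)
    exact ⟨m - r, fun j hj => hm _ fun h => hj (eq_sub_of_add_eq h)⟩
  · intro t ht
    obtain ⟨m, hm⟩ := h.outNbr t (hr ▸ ht)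
    exact ⟨m - r, fun j hj => hm _ fun h => hj (eq_sub_of_add_eq h)⟩
  · simpa only [hr] using h.outer

variable [DecidableEq V]

theorem strongArcDecomp_of_model (h : CycleConfig A g) {k : ℕ} {K : Fin k → List (Fin 4)}
    (hmodel : ModelDecomposes K) {s : Fin k → V} (hs : Function.Injective s)
    (hsg : ∀ t, s t ∉ Set.range g)
    (hK : ∀ t, ∀ i ∈ K t, (g i, s t) ∈ A ∧ (s t, g (i + 2)) ∈ A)
    (hdiag : ∀ i, (∀ t, i ∉ K t) → (g i, g (i + 2)) ∈ A) : StrongArcDecomp A := by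
  choose p hp using fun t => h.inNbr (s t) (hsg t)
  choose q hq using fun t => h.outNbr (s t) (hsg t)
  obtain ⟨w, ⟨h₁, h₂, hd⟩, hw⟩ := hmodel p q
  have hadj : ∀ x y, splitModel K p q x y → (Sum.elim g s x, Sum.elim g s y) ∈ A := by
    rintro (i | t) (j | t') hxy
    · rcases hxy with rfl | ⟨rfl, hi⟩
      · exact h.cycle i
      · exact hdiag i hi
    · rcases hxy with hi | hi
      · exact hp t' i hi
      · exact (hK t' i hi).1
    · rcases hxy with hj | hj
      · exact hq t j hj
      · have := (hK t _ hj).2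
        rwa [add_assoc, show (2 : Fin 4) + 2 = 0 from rfl, add_zero] at this
    · exact hxy.elim
  have hφ : Function.Injective (Sum.elim g s) :=
    h.inj.sumElim hs fun i t hit => hsg t ⟨i, hit⟩
  have hne : ∀ m : Fin 4, m + 1 ≠ m ∧ m + 2 ≠ m ∧ m + 1 ≠ m + 2 := by decide
  refine strongArcDecomp_of_closedWalks hφ h₁ h₂
    (fun e he => hadj _ _ (hw e (List.mem_append_left _ he)))
    (fun e he => hadj _ _ (hw e (List.mem_append_right _ he))) hd (fun v hv => ?_) (fun v hv => ?_)
  · obtain ⟨m, hm⟩ := h.inNbr v fun ⟨i, hi⟩ => hv ⟨.inl i, hi⟩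
    obtain ⟨h1, h2, h3⟩ := hne m
    exact ⟨.inl (m + 1), .inl (m + 2), fun h => h3 (Sum.inl.inj h), hm _ h1, hm _ h2⟩
  · obtain ⟨m, hm⟩ := h.outNbr v fun ⟨i, hi⟩ => hv ⟨.inl i, hi⟩
    obtain ⟨h1, h2, h3⟩ := hne m
    exact ⟨.inl (m + 1), .inl (m + 2), fun h => h3 (Sum.inl.inj h), hm _ h1, hm _ h2⟩

theorem strongArcDecomp_of_consecutive_missing (h : CycleConfig A g)
    (h0 : (g 0, g 2) ∉ A) (h1 : (g 1, g 3) ∉ A) : StrongArcDecomp A := by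
  have h2 : (g 2, g 0) ∈ A := (h.diag 0).resolve_left h0
  have h3 : (g 3, g 1) ∈ A := (h.diag 1).resolve_left h1
  obtain ⟨t, ht, ht0, ht2⟩ := h.split 0 h0
  obtain ⟨u, hu, hu1, hu3⟩ := h.split 1 h1
  by_cases htu : t = u
  · subst htu
    refine h.strongArcDecomp_of_model modelDecomposes_same (s := fun _ => t)
      (Function.injective_of_subsingleton _) (fun _ => ht) ?_ ?_
    · simpa using ⟨⟨ht0, ht2⟩, hu1, hu3⟩
    · simpa [Fin.forall_fin_succ] using ⟨h2, h3⟩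
  · refine h.strongArcDecomp_of_model modelDecomposes_two (s := ![t, u]) ?_ ?_ ?_ ?_
    · intro i j
      fin_cases i <;> fin_cases j <;> simp [htu, Ne.symm htu]
    · exact Fin.forall_fin_two.2 ⟨ht, hu⟩
    · simpa [Fin.forall_fin_two] using ⟨⟨ht0, ht2⟩, hu1, hu3⟩
    · simpa [Fin.forall_fin_succ] using ⟨h2, h3⟩

theorem strongArcDecomp_of_one_missing (h : CycleConfig A g)
    (h0 : (g 0, g 2) ∉ A) (h1 : (g 1, g 3) ∈ A) (h3 : (g 3, g 1) ∈ A) : StrongArcDecomp A := by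
  have h2 : (g 2, g 0) ∈ A := (h.diag 0).resolve_left h0
  obtain ⟨t, ht, ht0, ht2⟩ := h.split 0 h0
  refine h.strongArcDecomp_of_model modelDecomposes_one (s := fun _ => t)
    (Function.injective_of_subsingleton _) (fun _ => ht) ?_ ?_
  · simpa using ⟨ht0, ht2⟩
  · simpa [Fin.forall_fin_succ] using ⟨h1, h2, h3⟩

theorem strongArcDecomp (h : CycleConfig A g) : StrongArcDecomp A := by
  by_cases hcons : ∃ i, (g i, g (i + 2)) ∉ A ∧ (g (i + 1), g (i + 1 + 2)) ∉ A
  · obtain ⟨i, h0, h1⟩ := hcons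
    refine (h.rotate i).strongArcDecomp_of_consecutive_missing ?_ ?_
    · simpa [add_comm] using h0
    · convert h1 using 4 <;> grind
  push Not at hcons
  by_cases hone : ∃ i, (g i, g (i + 2)) ∉ A
  · obtain ⟨i, h0⟩ := hone
    refine (h.rotate i).strongArcDecomp_of_one_missing ?_ ?_ ?_
    · simpa [add_comm] using h0
    · convert hcons i h0 using 3 <;> grind
    · by_contra h3
      refine h0 ?_
      have := hcons (3 + i) (by convert h3 using 4; grind)
      convert this using 3 <;> grind
  push Not at hone
  obtain ⟨t, ht⟩ := h.outer
  exact h.strongArcDecomp_of_model modelDecomposes_none (s := fun _ => t)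
    (Function.injective_of_subsingleton _) (fun _ => ht) (by simp) fun i _ => hone i

end CycleConfig

/-- A set of at least three pairs, all of the form `c j` with `j : Fin 4`, misses at most one of
the `c j`. -/
theorem exists_forall_ne_mem_of_three_le_card {α : Type*} [DecidableEq α] {F : Finset α}
    (c : Fin 4 → α) (hF : ∀ e ∈ F, ∃ j, e = c j) (hcard : 3 ≤ F.card) :
    ∃ m, ∀ j ≠ m, c j ∈ F := by
  by_contra! hcon
  obtain ⟨i, -, hi⟩ := hcon 0
  obtain ⟨j, hji, hj⟩ := hcon i
  have hsub : F ⊆ (Finset.univ \ {i, j}).image c := by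
    intro e he
    obtain ⟨m, rfl⟩ := hF e he
    refine Finset.mem_image_of_mem c ?_
    simp only [Finset.mem_sdiff, Finset.mem_univ, true_and, Finset.mem_insert,
      Finset.mem_singleton, not_or]
    exact ⟨fun h => hi (h ▸ he), fun h => hj (h ▸ he)⟩
  have h1 := (Finset.card_le_card hsub).trans Finset.card_image_le
  rw [Finset.card_sdiff_of_subset (Finset.subset_univ _), Finset.card_pair hji.symm] at h1
  simp at h1
  omega

theorem mem_iff_mem_S4M {M : Multiset (Fin 4 × Fin 4)}
    (hM : M ∈ ({S4M, S41M, S42M, S43M} : Set (Multiset (Fin 4 × Fin 4)))) (e : Fin 4 × Fin 4) :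
    e ∈ M ↔ e ∈ S4M := by
  rcases hM with rfl | rfl | rfl | rfl
  · rfl
  all_goals revert e; decide

theorem CycleConfig.of_splitsOff {V : Type*} [Fintype V] [DecidableEq V]
    {V₁ V₂ : Finset V} {A : Finset (V × V)} (hsplit : IsSplitDigraph V₁ V₂ A)
    (hdeg : ∀ t ∈ V₁, 3 ≤ outDeg A t ∧ 3 ≤ inDeg A t)
    {S : Multiset (V × V × V)} {B : Multiset (V × V)} (hB : SplitsOff A V₁ V₂ S B)
    {f : V → Fin 4} (hf : Set.BijOn f ↑V₂ Set.univ)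
    (hM : ((B.filter fun e => e.1 ∈ V₂ ∧ e.2 ∈ V₂).map fun e => (f e.1, f e.2)) ∈
        ({S4M, S41M, S42M, S43M} : Set (Multiset (Fin 4 × Fin 4)))) :
    ∃ g, CycleConfig A g := by
  obtain ⟨⟨t₀, ht₀⟩, -, hdisj, hun, -, hindep, hsemi⟩ := hsplit
  obtain ⟨hS, -, rfl⟩ := hB
  choose g hg hfg using fun i => hf.surjOn (Set.mem_univ i)
  have hgf : ∀ v ∈ V₂, g (f v) = v := fun v hv => hf.injOn (hg _) hv (hfg _)
  have hinj : Function.Injective g := fun i j hij => by rw [← hfg i, hij, hfg]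
  have hrange : ∀ t, t ∉ Set.range g ↔ t ∈ V₁ := by
    intro t
    have ht : t ∈ V₁ ∪ V₂ := hun ▸ Finset.mem_univ t
    constructor
    · intro h
      exact (Finset.mem_union.1 ht).resolve_right fun h2 => h ⟨_, hgf t h2⟩
    · rintro h ⟨i, rfl⟩
      exact Finset.disjoint_left.1 hdisj h (hg i)
  have hV₂ : ∀ t ∈ V₁, ∀ v, ((t, v) ∈ A ∨ (v, t) ∈ A) → ∃ j, v = g j := by
    intro t ht v hv
    have hv2 : v ∉ V₁ := fun h => hv.elim (hindep t ht v h) (hindep v h t ht)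
    rw [← hrange, not_not] at hv2
    exact hv2.imp fun _ h => h.symm
  have hmem := mem_iff_mem_S4M hM
  have harc : ∀ i j, (i, j) ∈ S4M →
      (g i, g j) ∈ A ∨ ∃ t ∈ V₁, (g i, t) ∈ A ∧ (t, g j) ∈ A := by
    intro i j hij
    obtain ⟨⟨u, v⟩, he, huv⟩ := Multiset.mem_map.1 ((hmem _).2 hij)
    obtain ⟨he, hu, hv⟩ := Multiset.mem_filter.1 he
    obtain ⟨rfl, rfl⟩ := Prod.mk.inj huv
    rw [hgf u hu, hgf v hv]
    rcases Multiset.mem_add.1 he with he | he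
    · exact Or.inl (Multiset.mem_of_le (Multiset.sub_le_self _ _) he)
    · obtain ⟨s, hs, hse⟩ := Multiset.mem_map.1 he
      obtain ⟨rfl, rfl⟩ := Prod.mk.inj hse
      obtain ⟨ht, -, -, -, h1, h2⟩ := hS s hs
      exact Or.inr ⟨s.2.1, ht, h1, h2⟩
  have hback : ∀ i j, (g i, g j) ∈ A → (i, j) ∈ S4M := by
    intro i j hij
    refine (hmem _).1 (Multiset.mem_map.2 ⟨(g i, g j), Multiset.mem_filter.2
      ⟨Multiset.mem_add.2 (Or.inl ?_), hg i, hg j⟩, by simp only [hfg]⟩)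
    rw [Multiset.mem_sub, Multiset.count_eq_zero_of_notMem, Multiset.count_pos]
    · exact hij
    · intro h
      obtain ⟨s, hs, hse⟩ := Multiset.mem_bind.1 h
      have ht := (hrange _).2 (hS s hs).1
      simp only [Multiset.insert_eq_cons, Multiset.mem_cons, Multiset.mem_singleton,
        Prod.mk.injEq] at hse
      rcases hse with ⟨-, h⟩ | ⟨h, -⟩
      · exact ht ⟨_, h⟩
      · exact ht ⟨_, h⟩
  have hsemi' : ∀ i j, i ≠ j → (g i, g j) ∈ A ∨ (g j, g i) ∈ A :=
    fun i j hij => hsemi _ (hg i) _ (hg j) (hinj.ne hij)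
  refine ⟨g, hinj, fun i => ?_, fun i => ?_, fun i hi => ?_, fun t ht => ?_, fun t ht => ?_,
    t₀, (hrange _).2 ht₀⟩
  · refine (hsemi' i (i + 1) (by revert i; decide)).resolve_right fun h => ?_
    exact absurd (hback _ _ h) (by clear h; revert i; decide)
  · exact hsemi' i (i + 2) (by revert i; decide)
  · obtain ⟨t, ht, h⟩ := (harc i (i + 2) (by clear hi; revert i; decide)).resolve_left hi
    exact ⟨t, (hrange t).2 ht, h⟩
  · have ht := (hrange t).1 ht
    obtain ⟨m, hm⟩ := exists_forall_ne_mem_of_three_le_card (fun j => (g j, t)) (by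
      rintro ⟨u, v⟩ he
      obtain ⟨hA, h⟩ := Finset.mem_filter.1 he
      obtain rfl : v = t := h
      obtain ⟨j, rfl⟩ := hV₂ _ ht u (Or.inr hA)
      exact ⟨j, rfl⟩) (hdeg t ht).2
    exact ⟨m, fun j hj => (Finset.mem_filter.1 (hm j hj)).1⟩
  · have ht := (hrange t).1 ht
    obtain ⟨m, hm⟩ := exists_forall_ne_mem_of_three_le_card (fun j => (t, g j)) (by
      rintro ⟨u, v⟩ he
      obtain ⟨hA, h⟩ := Finset.mem_filter.1 he
      obtain rfl : u = t := h
      obtain ⟨j, rfl⟩ := hV₂ _ ht v (Or.inl hA)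
      exact ⟨j, rfl⟩) (hdeg t ht).1
    exact ⟨m, fun j hj => (Finset.mem_filter.1 (hm j hj)).1⟩

/-- Lemma 2.6: let `D = (V₁, V₂; A)` be a split digraph in which every vertex of `V₁`
has out- and in-degree at least 3, and let `D*` (with arc multiset `B`) be obtained
from `D` by splitting off some pairs at vertices of `V₁`.  If `D*⟨V₂⟩` is isomorphic
to one of `S₄`, `S₄,₁`, `S₄,₂`, `S₄,₃`, then `D` has a strong arc decomposition. -/
theorem stmt6 {V : Type*} [Fintype V] [DecidableEq V]
    (V₁ V₂ : Finset V) (A : Finset (V × V))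
    (hsplit : IsSplitDigraph V₁ V₂ A)
    (hdeg : ∀ t ∈ V₁, 3 ≤ outDeg A t ∧ 3 ≤ inDeg A t)
    (S : Multiset (V × V × V)) (B : Multiset (V × V))
    (hB : SplitsOff A V₁ V₂ S B)
    (hiso : ∃ f : V → Fin 4, Set.BijOn f ↑V₂ Set.univ ∧
      ((B.filter fun e => e.1 ∈ V₂ ∧ e.2 ∈ V₂).map fun e => (f e.1, f e.2)) ∈
        ({S4M, S41M, S42M, S43M} : Set (Multiset (Fin 4 × Fin 4)))) :
    StrongArcDecomp A := by
  obtain ⟨f, hf, hM⟩ := hiso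
  obtain ⟨g, hg⟩ := CycleConfig.of_splitsOff hsplit hdeg hB hf hM
  exact hg.strongArcDecomp
end
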